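/- arXiv:1601.03856 — 2 statements merged into one kernel-verified Lean document; each statement's English description precedes it below -/
import Mathlib

section
/- Let n ≥ 1, k ∈ {1,…,n} and s > 1. There is a constant C > 0, depending only on n and s, such that for every ball B = B(x₀, r) ⊂ ℝ^n with r ≥ min(1, |x₀|/2) one has ∫_B (log(e + x_k²))^{-s} dx ≤ C |B| (log(e + r))^{-s}, where x_k denotes the k-th coordinate of x. -/
open MeasureTheory Metric Real Filter
open scoped ENNReal Topology BigOperators

noncomputable section

/-- `ℝⁿ` with the Euclidean structure. -/
abbrev Eucl (n : ℕ) := EuclideanSpace ℝ (Fin n)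

/-- The part of a Euclidean ball lying in a coordinate slab of half-width `t` is contained in a box
with one side `2t` and the others `2r`. -/
theorem volume_real_ball_inter_slab_le {n : ℕ} (k : Fin n) (x₀ : Eucl n) {r t : ℝ}
    (hr : 0 ≤ r) (ht : 0 ≤ t) :
    volume.real (ball x₀ r ∩ {x : Eucl n | |x k| ≤ t}) ≤ (2 * r) ^ (n - 1) * (2 * t) := by
  set I : Fin n → Set ℝ :=
    Function.update (fun i => Set.Icc (x₀ i - r) (x₀ i + r)) k (Set.Icc (-t) t) with hI
  have hsub : ball x₀ r ∩ {x : Eucl n | |x k| ≤ t} ⊆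
      (WithLp.ofLp : Eucl n → Fin n → ℝ) ⁻¹' Set.pi Set.univ I := by
    rintro x ⟨hx, hxk⟩ i -
    by_cases hik : i = k
    · subst hik
      simpa [hI] using abs_le.1 hxk
    · have h1 : |x i - x₀ i| ≤ r := by
        have := PiLp.norm_apply_le (x - x₀) i
        rw [mem_ball_iff_norm] at hx
        simpa using this.trans hx.le
      rw [abs_le] at h1
      simp only [hI, Function.update_of_ne hik, Set.mem_Icc]
      constructor <;> linarith
  have hImeas : ∀ i, MeasurableSet (I i) := by
    intro i
    by_cases hik : i = k
    · subst hik
      simp [hI]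
    · simp [hI, Function.update_of_ne hik]
  have hvol : volume ((WithLp.ofLp : Eucl n → Fin n → ℝ) ⁻¹' Set.pi Set.univ I)
      = ENNReal.ofReal ((2 * r) ^ (n - 1) * (2 * t)) := by
    rw [(PiLp.volume_preserving_ofLp (Fin n)).measure_preimage
      (MeasurableSet.univ_pi hImeas).nullMeasurableSet, volume_pi_pi,
      ← Finset.prod_erase_mul _ _ (Finset.mem_univ k)]
    have h1 : ∀ i ∈ Finset.univ.erase k, volume (I i) = ENNReal.ofReal (2 * r) := by
      intro i hi
      rw [hI, Function.update_of_ne (Finset.ne_of_mem_erase hi), Real.volume_Icc]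
      ring_nf
    have h2 : volume (I k) = ENNReal.ofReal (2 * t) := by
      rw [hI, Function.update_self, Real.volume_Icc]
      ring_nf
    rw [Finset.prod_congr rfl h1, h2, Finset.prod_const, Finset.card_erase_of_mem
      (Finset.mem_univ k), Finset.card_univ, Fintype.card_fin,
      ENNReal.ofReal_mul (p := (2 * r) ^ (n - 1)) (by positivity),
      ENNReal.ofReal_pow (by positivity)]
  refine ENNReal.toReal_le_of_le_ofReal (by positivity) ?_
  exact (measure_mono hsub).trans hvol.le

theorem one_le_log_exp_one_add {y : ℝ} (hy : 0 ≤ y) : 1 ≤ Real.log (Real.exp 1 + y) := by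
  rw [Real.le_log_iff_exp_le (by positivity)]
  linarith

theorem log_exp_one_add_rpow_le {s r : ℝ} (hs : 0 < s) (hr : 1 ≤ r) :
    Real.log (Real.exp 1 + r) ^ s ≤ 2 * (2 * s) ^ s * √r := by
  have hL := one_le_log_exp_one_add (zero_le_one.trans hr)
  have he : Real.exp 1 < 3 := Real.exp_one_lt_three
  have hε : 0 < 1 / (2 * s) := by positivity
  have hpos : 0 < Real.exp 1 + r := by positivity
  calc Real.log (Real.exp 1 + r) ^ s
      ≤ ((Real.exp 1 + r) ^ (1 / (2 * s)) / (1 / (2 * s))) ^ s :=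
        Real.rpow_le_rpow (by linarith) (Real.log_le_rpow_div hpos.le hε) hs.le
    _ = (2 * s) ^ s * √(Real.exp 1 + r) := by
        rw [div_div_eq_mul_div, div_one, Real.mul_rpow (by positivity) (by positivity),
          ← Real.rpow_mul hpos.le, Real.sqrt_eq_rpow, mul_comm]
        congr 2
        field_simp
    _ ≤ (2 * s) ^ s * (2 * √r) := by
        gcongr
        rw [Real.sqrt_le_left (by positivity), mul_pow, Real.sq_sqrt (by linarith)]
        linarith
    _ = _ := by ring

/-- On a ball `B(x₀,r)` with `r ≥ min(1,|x₀|/2)` one has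
`∫_B (log(e+x_k²))^{-s} dx ≤ C |B| (log(e+r))^{-s}` for `s > 1`. -/
theorem integral_log_coord_rpow_neg_le
    (n : ℕ) (hn : 1 ≤ n) (k : Fin n) (s : ℝ) (hs : 1 < s) :
    ∃ C : ℝ, 0 < C ∧
      ∀ (x₀ : Eucl n) (r : ℝ), 0 < r → min 1 (‖x₀‖ / 2) ≤ r →
        ∫ x in ball x₀ r, Real.log (Real.exp 1 + (x k) ^ 2) ^ (-s)
          ≤ C * (volume (ball x₀ r)).toReal * Real.log (Real.exp 1 + r) ^ (-s) := by
  have hs0 : 0 < s := by linarith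
  set c : ℝ := volume.real (ball (0 : Eucl n) 1) with hc
  have hc0 : 0 < c := ENNReal.toReal_pos (measure_ball_pos _ _ one_pos).ne' measure_ball_lt_top.ne
  refine ⟨2 ^ s + (1 + 2 ^ n * (2 * (2 * s) ^ s) / c), by positivity, ?_⟩
  intro x₀ r hr _
  have hV : volume.real (ball x₀ r) = r ^ n * c := by
    rw [measureReal_def, Measure.addHaar_ball_of_pos _ _ hr, ENNReal.toReal_mul,
      ENNReal.toReal_ofReal (by positivity), finrank_euclideanSpace_fin, hc, measureReal_def]
  set L := Real.log (Real.exp 1 + r) with hL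
  have hL1 : 1 ≤ L := one_le_log_exp_one_add hr.le
  have hLs : 0 < L ^ (-s) := Real.rpow_pos_of_pos (by linarith) _
  have hLmul : L ^ s * L ^ (-s) = 1 := by
    rw [← Real.rpow_add (by linarith), add_neg_cancel, Real.rpow_zero]
  change _ ≤ _ * volume.real (ball x₀ r) * _
  have hf0 : ∀ x : Eucl n, 0 ≤ Real.log (Real.exp 1 + (x k) ^ 2) ^ (-s) := fun x =>
    Real.rpow_nonneg (zero_le_one.trans (one_le_log_exp_one_add (sq_nonneg _))) _
  have hf1 : ∀ x : Eucl n, Real.log (Real.exp 1 + (x k) ^ 2) ^ (-s) ≤ 1 := fun x =>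
    Real.rpow_le_one_of_one_le_of_nonpos (one_le_log_exp_one_add (sq_nonneg _)) (by linarith)
  have hconst : ∀ a : ℝ, IntegrableOn (fun _ : Eucl n => a) (ball x₀ r) := fun a =>
    integrableOn_const measure_ball_lt_top.ne
  have hV0 : 0 ≤ volume.real (ball x₀ r) := measureReal_nonneg
  rcases le_total r 1 with hr1 | hr1
  · have hL2 : L ≤ 2 := by
      have := Real.add_one_le_exp (1 : ℝ)
      rw [hL, Real.log_le_iff_le_exp (by positivity),
        show (2 : ℝ) = 1 + 1 by norm_num, Real.exp_add]
      nlinarith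
    have h1 : 1 ≤ 2 ^ s * L ^ (-s) := by
      rw [← hLmul]
      gcongr
    calc ∫ x in ball x₀ r, Real.log (Real.exp 1 + (x k) ^ 2) ^ (-s)
        ≤ ∫ _ in ball x₀ r, (1 : ℝ) :=
          integral_mono_of_nonneg (ae_of_all _ hf0) (hconst 1) (ae_of_all _ hf1)
      _ = volume.real (ball x₀ r) * 1 := by simp
      _ ≤ volume.real (ball x₀ r) * (2 ^ s * L ^ (-s)) := by gcongr
      _ = 2 ^ s * volume.real (ball x₀ r) * L ^ (-s) := by ring
      _ ≤ _ := by
          gcongr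
          exact le_add_of_nonneg_right (by positivity)
  · set S : Set (Eucl n) := {x | |x k| ≤ √r} with hS
    have hSm : MeasurableSet S := by
      apply IsClosed.measurableSet
      exact isClosed_le (by fun_prop) continuous_const
    have hfS : ∀ x : Eucl n, Real.log (Real.exp 1 + (x k) ^ 2) ^ (-s)
        ≤ L ^ (-s) + S.indicator (fun _ => 1) x := by
      intro x
      by_cases hx : x ∈ S
      · rw [Set.indicator_of_mem hx]
        linarith [hf1 x]
      · rw [Set.indicator_of_notMem hx, add_zero]
        have hx' : √r < |x k| := not_le.1 hx
        have hrx : r ≤ (x k) ^ 2 := by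
          rw [← sq_abs]
          exact (Real.lt_sq_of_sqrt_lt hx').le
        refine Real.rpow_le_rpow_of_nonpos (by linarith) ?_ (by linarith)
        exact Real.log_le_log (by positivity) (by linarith)
    have hslab : volume.real (ball x₀ r ∩ S) ≤
        2 ^ n * (2 * (2 * s) ^ s) / c * volume.real (ball x₀ r) * L ^ (-s) := by
      have hbox := volume_real_ball_inter_slab_le k x₀ hr.le (Real.sqrt_nonneg r)
      have hlog := log_exp_one_add_rpow_le hs0 hr1
      refine hbox.trans ?_
      rw [hV]
      obtain ⟨m, rfl⟩ : ∃ m, n = m + 1 := ⟨n - 1, by omega⟩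
      calc (2 * r) ^ (m + 1 - 1) * (2 * √r)
          = 2 ^ (m + 1) * r ^ m * √r * (L ^ s * L ^ (-s)) := by
            rw [hLmul, Nat.add_sub_cancel]
            ring
        _ ≤ 2 ^ (m + 1) * r ^ m * √r * (2 * (2 * s) ^ s * √r * L ^ (-s)) := by gcongr
        _ = 2 ^ (m + 1) * r ^ m * (√r * √r) * (2 * (2 * s) ^ s * L ^ (-s)) := by ring
        _ = _ := by
            rw [Real.mul_self_sqrt hr.le]
            field_simp
            ring
    have hind : IntegrableOn (S.indicator fun _ => (1 : ℝ)) (ball x₀ r) :=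
      (hconst 1).indicator hSm
    calc ∫ x in ball x₀ r, Real.log (Real.exp 1 + (x k) ^ 2) ^ (-s)
        ≤ ∫ x in ball x₀ r, (L ^ (-s) + S.indicator (fun _ => 1) x) :=
          integral_mono_of_nonneg (ae_of_all _ hf0) ((hconst _).add hind) (ae_of_all _ hfS)
      _ = volume.real (ball x₀ r) * L ^ (-s) + volume.real (ball x₀ r ∩ S) := by
          rw [integral_add (hconst _) hind, setIntegral_indicator hSm]
          simp
      _ ≤ volume.real (ball x₀ r) * L ^ (-s) +
          2 ^ n * (2 * (2 * s) ^ s) / c * volume.real (ball x₀ r) * L ^ (-s) := by gcongr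
      _ = (1 + 2 ^ n * (2 * (2 * s) ^ s) / c) * volume.real (ball x₀ r) * L ^ (-s) := by ring
      _ ≤ _ := by
          have h2s : (0 : ℝ) ≤ 2 ^ s := by positivity
          exact mul_le_mul_of_nonneg_right
            (mul_le_mul_of_nonneg_right (le_add_of_nonneg_left h2s) hV0) hLs.le
end
end

section
/- Let n ≥ 1 and let φ ∈ C_c^∞(ℝ^n) be a real-valued radial function supported in the closed unit ball such that 4π² ∫₀^∞ t |ξ|² |φ̂(tξ)|² dt = 1 for every ξ ∈ ℝ^n with ξ ≠ 0. Then for every Schwartz function f on ℝ^n and every x ∈ ℝ^n, the function t ↦ t^{-1} (f * φ_t * (Δφ)_t)(x) is absolutely integrable on (0,∞) and f(x) = − ∫₀^∞ (f * φ_t * (Δφ)_t)(x) dt/t, where φ_t(y) = t^{-n} φ(y/t), (Δφ)_t(y) = t^{-n} (Δφ)(y/t), and Δ is the Laplacian on ℝ^n. -/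
open MeasureTheory Metric Real Filter
open scoped ENNReal Topology BigOperators FourierTransform SchwartzMap

noncomputable section

/-- The dilated function `φ_t(x) = t^{-n} φ(x/t)`. -/
def dil (n : ℕ) (φ : Eucl n → ℝ) (t : ℝ) (x : Eucl n) : ℝ :=
  (t ^ n)⁻¹ * φ (t⁻¹ • x)

/-- Convolution of two real-valued functions on `ℝⁿ`. -/
def conv (n : ℕ) (f g : Eucl n → ℝ) (x : Eucl n) : ℝ :=
  ∫ y, f (x - y) * g y

/-- The Laplacian `Δφ = Σ_i ∂²φ/∂x_i²`. -/
def lap (n : ℕ) (φ : Eucl n → ℝ) (x : Eucl n) : ℝ :=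
  ∑ i, fderiv ℝ (fun y => fderiv ℝ φ y (EuclideanSpace.single i 1)) x
    (EuclideanSpace.single i 1)

open FourierTransform Convolution in
theorem SchwartzMap.integral_integral_mul_mul_eq_fourier {n : ℕ} (F P Q : 𝓢(Eucl n, ℂ))
    (x : Eucl n) :
    ∫ y, (∫ z, F (x - y - z) * P z) * Q y =
      ∫ ξ, 𝐞 (inner ℝ ξ x) • (𝓕 F ξ * 𝓕 P ξ * 𝓕 Q ξ) := by
  let B := ContinuousLinearMap.mul ℂ ℂ
  have h1 : ∀ w, SchwartzMap.convolution B P F w = ∫ z, F (w - z) * P z := by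
    intro w
    rw [SchwartzMap.convolution_apply]
    simp [MeasureTheory.convolution, B, mul_comm]
  have h2 : SchwartzMap.convolution B Q (SchwartzMap.convolution B P F) x =
      ∫ y, (∫ z, F (x - y - z) * P z) * Q y := by
    rw [SchwartzMap.convolution_apply]
    simp [MeasureTheory.convolution, B, mul_comm, h1]
  rw [← h2]
  have h3 : SchwartzMap.convolution B Q (SchwartzMap.convolution B P F) =
    𝓕⁻ (𝓕 (SchwartzMap.convolution B Q (SchwartzMap.convolution B P F))) := by simp
  rw [h3, SchwartzMap.fourierInv_coe, Real.fourierInv_eq]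
  refine integral_congr_ae (Eventually.of_forall fun ξ => ?_)
  simp only [SchwartzMap.fourier_convolution, SchwartzMap.pairing_apply_apply, B,
    ContinuousLinearMap.mul_apply']
  congr 1
  ring

open FourierTransform in
theorem fourier_dilation {n : ℕ} (p : Eucl n → ℂ) {t : ℝ} (ht : 0 < t) (ξ : Eucl n) :
    𝓕 (fun x => ((t ^ n)⁻¹ : ℝ) • p (t⁻¹ • x)) ξ = 𝓕 p (t • ξ) := by
  rw [Real.fourier_eq, Real.fourier_eq]
  have key := Measure.integral_comp_inv_smul (volume : Measure (Eucl n))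
    (fun y => 𝐞 (-inner ℝ y (t • ξ)) • p y) t
  have h : ∀ v : Eucl n, 𝐞 (-inner ℝ v ξ) • (((t ^ n)⁻¹ : ℝ) • p (t⁻¹ • v)) =
      ((t ^ n)⁻¹ : ℝ) • (𝐞 (-inner ℝ (t⁻¹ • v) (t • ξ)) • p (t⁻¹ • v)) := by
    intro v
    rw [real_inner_smul_left, real_inner_smul_right, inv_mul_cancel_left₀ ht.ne', smul_comm]
  simp_rw [h]
  rw [integral_smul, key, smul_smul]
  simp [abs_of_pos ht, ht.ne']

/-- The dilation `x ↦ t⁻ⁿ P(x / t)` of a Schwartz function. -/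
def SchwartzMap.dilation {n : ℕ} (P : 𝓢(Eucl n, ℂ)) (t : ℝ) (ht : t ≠ 0) : 𝓢(Eucl n, ℂ) :=
  ((t ^ n)⁻¹ : ℝ) • SchwartzMap.compCLMOfContinuousLinearEquiv ℝ
    (ContinuousLinearEquiv.smulLeft (Units.mk0 t⁻¹ (inv_ne_zero ht))) P

theorem SchwartzMap.dilation_apply {n : ℕ} (P : 𝓢(Eucl n, ℂ)) (t : ℝ) (ht : t ≠ 0)
    (x : Eucl n) : P.dilation t ht x = ((t ^ n)⁻¹ : ℝ) • P (t⁻¹ • x) := rfl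

open FourierTransform in
theorem SchwartzMap.fourier_dilation {n : ℕ} (P : 𝓢(Eucl n, ℂ)) {t : ℝ} (ht : 0 < t)
    (ξ : Eucl n) : 𝓕 (P.dilation t ht.ne') ξ = 𝓕 P (t • ξ) :=
  _root_.fourier_dilation P ht ξ

open FourierTransform Laplacian in
theorem SchwartzMap.fourier_laplacian_apply {n : ℕ} (P : 𝓢(Eucl n, ℂ)) (ξ : Eucl n) :
    𝓕 (Δ P) ξ = -(4 * π ^ 2 * ‖ξ‖ ^ 2 : ℝ) * 𝓕 P ξ := by
  rw [SchwartzMap.laplacian_eq_fourierMultiplierCLM, SchwartzMap.fourierMultiplierCLM_apply]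
  simp only [FourierTransform.fourier_fourierInv_eq, smul_apply,
    FourierTransform.fourier_smul]
  rw [SchwartzMap.smulLeftCLM_apply_apply (by fun_prop)]
  simp
  ring

open Laplacian in
theorem SchwartzMap.laplacian_ofReal {n : ℕ} {φ : Eucl n → ℝ} (hφ : ContDiff ℝ (⊤ : ℕ∞) φ)
    (P : 𝓢(Eucl n, ℂ)) (hP : ∀ x, P x = φ x) (x : Eucl n) : (Δ P) x = (lap n φ x : ℂ) := by
  rw [SchwartzMap.laplacian_eq_sum (EuclideanSpace.basisFun (Fin n) ℝ)]
  simp only [sum_apply, lap, Complex.ofReal_sum]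
  refine Finset.sum_congr rfl fun i _ => ?_
  have lineDeriv_ofReal : ∀ (ψ : Eucl n → ℝ) (R : 𝓢(Eucl n, ℂ)), Differentiable ℝ ψ → (∀ x, R x = ψ x) →
      ∀ m x, (LineDeriv.lineDerivOp m R) x = (fderiv ℝ ψ x m : ℂ) := by
    intro ψ R hψ hR m x
    rw [SchwartzMap.lineDerivOp_apply_eq_fderiv]
    have hc : (R : Eucl n → ℂ) = Complex.ofRealCLM ∘ ψ := funext hR
    rw [hc, (Complex.ofRealCLM.hasFDerivAt.comp x (hψ x).hasFDerivAt).fderiv]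
    simp
  have hd : ContDiff ℝ 1 (fun y => fderiv ℝ φ y (EuclideanSpace.single i 1)) :=
    (hφ.fderiv_right (m := 1) (WithTop.coe_le_coe.2 le_top)).clm_apply contDiff_const
  rw [lineDeriv_ofReal (fun y => fderiv ℝ φ y (EuclideanSpace.single i 1)) _
    (hd.differentiable (by simp))]
  · simp
  · intro y
    rw [lineDeriv_ofReal φ P (hφ.differentiable (by simp)) hP]
    simp

open FourierTransform in
theorem fourier_sq_eq_norm_sq {n : ℕ} {φ : Eucl n → ℝ} (hφ : ∀ x, φ (-x) = φ x) (ξ : Eucl n) :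
    𝓕 (fun x => (φ x : ℂ)) ξ * 𝓕 (fun x => (φ x : ℂ)) ξ =
      ((‖𝓕 (fun x => (φ x : ℂ)) ξ‖ ^ 2 : ℝ) : ℂ) := by
  have h : (starRingEnd ℂ) (𝓕 (fun x => (φ x : ℂ)) ξ) = 𝓕 (fun x => (φ x : ℂ)) ξ := by
    rw [Real.fourier_eq, ← integral_conj, ← integral_neg_eq_self]
    refine integral_congr_ae (Eventually.of_forall fun v => ?_)
    simp [hφ, Circle.smul_def, ← Circle.coe_inv_eq_conj, AddChar.map_neg_eq_inv]
  rw [Complex.ofReal_pow, ← Complex.mul_conj', h]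

/-- **Calderón reproducing formula** (formula (2.12)): if `φ` is a smooth radial function
supported in the unit ball with `4π² ∫₀^∞ t |ξ|² |φ̂(tξ)|² dt = 1` for all `ξ ≠ 0`, then
`f = −∫₀^∞ f * φ_t * (Δφ)_t dt/t` pointwise for Schwartz `f`. -/
theorem calderon_reproducing_formula
    (n : ℕ) (hn : 1 ≤ n) (φ : Eucl n → ℝ)
    (hφ_smooth : ContDiff ℝ (⊤ : ℕ∞) φ)
    (hφ_supp : Function.support φ ⊆ Metric.closedBall 0 1)
    (hφ_radial : ∃ g : ℝ → ℝ, ∀ x, φ x = g ‖x‖)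
    (hφ_fourier : ∀ ξ : Eucl n, ξ ≠ 0 →
      ∫ t in Set.Ioi (0 : ℝ),
        4 * π ^ 2 * t * ‖ξ‖ ^ 2 * ‖𝓕 (fun x => (φ x : ℂ)) (t • ξ)‖ ^ 2 = 1)
    (f : 𝓢(Eucl n, ℝ)) (x : Eucl n) :
    IntegrableOn
      (fun t => conv n (conv n (⇑f) (dil n φ t)) (dil n (lap n φ) t) x / t)
      (Set.Ioi 0) volume ∧
    f x = - ∫ t in Set.Ioi (0 : ℝ),
      conv n (conv n (⇑f) (dil n φ t)) (dil n (lap n φ) t) x / t := by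
  obtain ⟨g, hg⟩ := hφ_radial
  have h_even : ∀ y, φ (-y) = φ y := fun y => by simp [hg]
  have hcs : HasCompactSupport φ :=
    HasCompactSupport.of_support_subset_isCompact (isCompact_closedBall 0 1) hφ_supp
  let P : 𝓢(Eucl n, ℂ) := (hcs.comp_left (g := Complex.ofReal) (by simp)).toSchwartzMap
    (Complex.ofRealCLM.contDiff.comp hφ_smooth)
  have hP : ∀ y, P y = φ y := fun y => rfl
  have hPF : ((𝓕 P : 𝓢(Eucl n, ℂ)) : Eucl n → ℂ) = 𝓕 (fun x => (φ x : ℂ)) := rfl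
  let F : 𝓢(Eucl n, ℂ) := SchwartzMap.postcompCLM (𝕜 := ℝ) Complex.ofRealCLM f
  have hF : ∀ y, F y = f y := fun y => rfl
  let K : ℝ → Eucl n → ℝ := fun t ξ => 4 * π ^ 2 * t * ‖ξ‖ ^ 2 * ‖𝓕 P (t • ξ)‖ ^ 2
  let H : ℝ → Eucl n → ℂ := fun t ξ => (K t ξ : ℂ) * (𝐞 (inner ℝ ξ x) • 𝓕 F ξ)
  have hconv : ∀ t ∈ Set.Ioi (0 : ℝ),
      ((conv n (conv n f (dil n φ t)) (dil n (lap n φ) t) x / t : ℝ) : ℂ) = - ∫ ξ, H t ξ := by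
    intro t ht
    have ht' : 0 < t := ht
    have key := SchwartzMap.integral_integral_mul_mul_eq_fourier F (P.dilation t ht'.ne')
      ((Laplacian.laplacian P).dilation t ht'.ne') x
    simp only [SchwartzMap.dilation_apply, SchwartzMap.fourier_dilation _ ht',
      SchwartzMap.laplacian_ofReal hφ_smooth P hP, SchwartzMap.fourier_laplacian_apply, hF, hP]
      at key
    have hl : ((conv n (conv n f (dil n φ t)) (dil n (lap n φ) t) x : ℝ) : ℂ) =
        ∫ y, (∫ z, (f (x - y - z) : ℂ) * ((t ^ n)⁻¹ : ℝ) • (φ (t⁻¹ • z) : ℂ)) *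
          ((t ^ n)⁻¹ : ℝ) • (lap n φ (t⁻¹ • y) : ℂ) := by
      simp only [conv, dil, ← integral_complex_ofReal, Complex.ofReal_mul, Complex.real_smul]
    rw [Complex.ofReal_div, hl, key, ← integral_div, ← integral_neg]
    refine integral_congr_ae (Eventually.of_forall fun ξ => ?_)
    have hs := fourier_sq_eq_norm_sq h_even (t • ξ)
    rw [← hPF, Complex.ofReal_pow] at hs
    have htc : (t : ℂ) ≠ 0 := by exact_mod_cast ht'.ne'
    simp only [H, K, Circle.smul_def, smul_eq_mul, Complex.ofReal_mul, norm_smul,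
      Real.norm_of_nonneg ht'.le, Complex.ofReal_pow, ← hs]
    field_simp
  have hHcont : Continuous (Function.uncurry H) := by
    have := (𝓕 F).continuous
    have h2 := Real.continuous_fourierChar
    simp only [H, Circle.smul_def, Function.uncurry_def]
    fun_prop
  have hne : ∀ᵐ ξ : Eucl n, ξ ≠ 0 := by
    have : Nonempty (Fin n) := ⟨⟨0, hn⟩⟩
    exact Measure.ae_ne volume 0
  have hKint : ∀ ξ : Eucl n, ξ ≠ 0 → ∫ t in Set.Ioi (0 : ℝ), K t ξ = 1 := hφ_fourier
  have hKi : ∀ ξ : Eucl n, ξ ≠ 0 → IntegrableOn (fun t => K t ξ) (Set.Ioi (0 : ℝ)) := by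
    intro ξ hξ
    by_contra h
    have := hKint ξ hξ
    rw [integral_undef h] at this
    exact zero_ne_one this
  have hHi : Integrable (Function.uncurry H) ((volume.restrict (Set.Ioi 0)).prod volume) := by
    rw [integrable_prod_iff' hHcont.aestronglyMeasurable]
    constructor
    · filter_upwards [hne] with ξ hξ
      exact (Integrable.ofReal (𝕜 := ℂ) (hKi ξ hξ)).mul_const (𝐞 (inner ℝ ξ x) • 𝓕 F ξ)
    · refine (𝓕 F).integrable.norm.congr ?_
      filter_upwards [hne] with ξ hξ
      have : ∀ t ∈ Set.Ioi (0 : ℝ), ‖Function.uncurry H (t, ξ)‖ = K t ξ * ‖𝓕 F ξ‖ := by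
        intro t ht
        have ht' : 0 < t := ht
        have : 0 ≤ K t ξ := by positivity
        simp [H, abs_of_nonneg this, Circle.norm_smul]
      rw [setIntegral_congr_fun measurableSet_Ioi this, integral_mul_const, hKint ξ hξ, one_mul]
  have hfx : (f x : ℂ) = ∫ ξ, 𝐞 (inner ℝ ξ x) • 𝓕 F ξ := by
    rw [← Real.fourierInv_eq, ← SchwartzMap.fourierInv_coe,
      FourierTransform.fourierInv_fourier_eq, hF]
  have hint : ∫ t in Set.Ioi (0 : ℝ), ∫ ξ, H t ξ = f x := by
    rw [integral_integral_swap hHi, hfx]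
    refine integral_congr_ae ?_
    filter_upwards [hne] with ξ hξ
    simp only [H]
    rw [integral_mul_const, integral_complex_ofReal, hKint ξ hξ, Complex.ofReal_one, one_mul]
  constructor
  · have h1 : IntegrableOn
        (fun t => ((conv n (conv n f (dil n φ t)) (dil n (lap n φ) t) x / t : ℝ) : ℂ))
        (Set.Ioi 0) :=
      IntegrableOn.congr_fun (Integrable.neg hHi.integral_prod_left)
        (fun t ht => (hconv t ht).symm) measurableSet_Ioi
    exact h1.re
  · apply Complex.ofReal_injective
    rw [Complex.ofReal_neg, ← integral_complex_ofReal,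
      setIntegral_congr_fun measurableSet_Ioi hconv, integral_neg, hint, neg_neg]
end
end
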